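/- Let E be a finite-dimensional spectral COSEA. A subset F⊆E is a commutative sub-COSEA of E (i.e. a sub-COSEA with a∘b=b∘a for all a,b∈F) if and only if there exist minimal sharp elements a_1,…,a_n of F with a_1⊕⋯⊕a_n=1 such that F={λ_1a_1⊕⋯⊕λ_na_n : λ_1,…,λ_n∈[0,1]}. -/

import Mathlib

set_option linter.unusedVariables false

universe u v

theorem prod_eq' {α β : Type*} {p q : α × β} (h1 : p.1 = q.1) (h2 : p.2 = q.2) : p = q :=
  Prod.ext_iff.mpr ⟨h1, h2⟩

/-- A convex sequential effect algebra (COSEA).  The partial sum `⊕` is modelled by a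
total operation `oplus` together with a definedness predicate `perp`; all axioms only
constrain `oplus` on pairs satisfying `perp`.  The scalar action is modelled by a total
map `smul : ℝ → E → E`, with axioms imposed for scalars in `[0,1]`. -/
structure COSEA (E : Type u) where
  zero : E
  one : E
  perp : E → E → Prop
  oplus : E → E → E
  compl : E → E
  smul : ℝ → E → E
  seq : E → E → E
  -- effect algebra axioms
  perp_comm : ∀ a b, perp a b → perp b a
  oplus_comm : ∀ a b, perp a b → oplus a b = oplus b a
  perp_assoc_right : ∀ a b c, perp a b → perp (oplus a b) c → perp b c
  perp_assoc_left : ∀ a b c, perp a b → perp (oplus a b) c → perp a (oplus b c)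
  oplus_assoc : ∀ a b c, perp a b → perp (oplus a b) c →
    oplus a (oplus b c) = oplus (oplus a b) c
  perp_compl : ∀ a, perp a (compl a)
  oplus_compl : ∀ a, oplus a (compl a) = one
  compl_unique : ∀ a b, perp a b → oplus a b = one → b = compl a
  perp_one : ∀ a, perp a one → a = zero
  -- convexity axioms
  smul_smul : ∀ α β a, 0 ≤ α → α ≤ 1 → 0 ≤ β → β ≤ 1 →
    smul α (smul β a) = smul (α * β) a
  perp_smul_self : ∀ α β a, 0 ≤ α → 0 ≤ β → α + β ≤ 1 → perp (smul α a) (smul β a)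
  add_smul : ∀ α β a, 0 ≤ α → 0 ≤ β → α + β ≤ 1 →
    smul (α + β) a = oplus (smul α a) (smul β a)
  perp_smul : ∀ lam a b, 0 ≤ lam → lam ≤ 1 → perp a b → perp (smul lam a) (smul lam b)
  smul_oplus : ∀ lam a b, 0 ≤ lam → lam ≤ 1 → perp a b →
    smul lam (oplus a b) = oplus (smul lam a) (smul lam b)
  one_smul : ∀ a, smul 1 a = a
  -- sequential product axioms
  seq_perp : ∀ a b c, perp b c → perp (seq a b) (seq a c)
  seq_oplus : ∀ a b c, perp b c → seq a (oplus b c) = oplus (seq a b) (seq a c)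
  one_seq : ∀ a, seq one a = a
  seq_eq_zero_comm : ∀ a b, seq a b = zero → seq b a = seq a b
  comm_compl : ∀ a b, seq a b = seq b a → seq a (compl b) = seq (compl b) a
  comm_assoc : ∀ a b c, seq a b = seq b a → seq a (seq b c) = seq (seq a b) c
  comm_seq : ∀ a b c, seq c a = seq a c → seq c b = seq b c →
    seq c (seq a b) = seq (seq a b) c
  comm_oplus : ∀ a b c, seq c a = seq a c → seq c b = seq b c → perp a b →
    seq c (oplus a b) = seq (oplus a b) c
  smul_seq : ∀ lam a b, 0 ≤ lam → lam ≤ 1 → seq (smul lam a) b = smul lam (seq a b)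
  seq_smul : ∀ lam a b, 0 ≤ lam → lam ≤ 1 → seq a (smul lam b) = smul lam (seq a b)

/-- `SumList C l s` : the orthogonal sum of the list `l` is defined and equals `s`. -/
inductive COSEA.SumList {E : Type u} (C : COSEA E) : List E → E → Prop
  | nil : COSEA.SumList C [] C.zero
  | cons {a : E} {l : List E} {s : E} :
      COSEA.SumList C l s → C.perp a s → COSEA.SumList C (a :: l) (C.oplus a s)

namespace COSEA

variable {E : Type u}

/-- `a ≤ b` in the effect-algebra order. -/
def le (C : COSEA E) (a b : E) : Prop := ∃ c, C.perp a c ∧ C.oplus a c = b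

/-- `a` is sharp: the greatest lower bound of `a` and `a'` is `0`,
i.e. every common lower bound of `a` and `a'` lies below `0`. -/
def IsSharp (C : COSEA E) (a : E) : Prop :=
  ∀ c, C.le c a → C.le c (C.compl a) → C.le c C.zero

/-- `a` is a one-dimensional (atomic) sharp element. -/
def IsOneDim (C : COSEA E) (a : E) : Prop :=
  C.IsSharp a ∧ a ≠ C.zero ∧
    ∀ b, C.le b a → ∃ lam : ℝ, 0 ≤ lam ∧ lam ≤ 1 ∧ b = C.smul lam a

/-- A state on a COSEA. -/
def IsState (C : COSEA E) (ω : E → ℝ) : Prop :=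
  (∀ a, 0 ≤ ω a ∧ ω a ≤ 1) ∧ ω C.one = 1 ∧
    ∀ a b, C.perp a b → ω (C.oplus a b) = ω a + ω b

/-- A context presented as an injective finite enumeration of one-dimensional
elements summing to `1`. -/
def IsContextFun (C : COSEA E) {n : ℕ} (a : Fin n → E) : Prop :=
  Function.Injective a ∧ (∀ i, C.IsOneDim (a i)) ∧ C.SumList (List.ofFn a) C.one

/-- A context as a set of effects. -/
def IsContext (C : COSEA E) (A : Set E) : Prop :=
  ∃ (n : ℕ) (a : Fin n → E), C.IsContextFun a ∧ Set.range a = A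

/-- `E` is finite-dimensional: there is no infinite sequence of one-dimensional
elements all of whose initial partial orthogonal sums are defined. -/
def FinDim (C : COSEA E) : Prop :=
  ¬ ∃ f : ℕ → E, (∀ i, C.IsOneDim (f i)) ∧
      ∀ n : ℕ, ∃ s, C.SumList ((List.range n).map f) s

/-- `E` is state-unique. -/
def StateUnique (C : COSEA E) : Prop :=
  ∀ a, C.IsOneDim a → ∃! ω : E → ℝ, C.IsState ω ∧ ω a = 1

/-- `E` is symmetric : `â(b) = b̂(a)` for all one-dimensional `a, b`. -/
def Symm (C : COSEA E) : Prop :=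
  ∀ a b ω ρ, C.IsOneDim a → C.IsOneDim b → C.IsState ω → C.IsState ρ →
    ω a = 1 → ρ b = 1 → ω b = ρ a

/-- `b = λ₁ a₁ ⊕ ⋯ ⊕ λₙ aₙ` with all `λ i ∈ [0,1]`. -/
def SpanRep (C : COSEA E) {n : ℕ} (a : Fin n → E) (lam : Fin n → ℝ) (b : E) : Prop :=
  (∀ i, 0 ≤ lam i ∧ lam i ≤ 1) ∧
    C.SumList (List.ofFn fun i => C.smul (lam i) (a i)) b

/-- `b ∈ E(A)` : `b` has a representation over the context `A`. -/
def InSpan (C : COSEA E) (A : Set E) (b : E) : Prop :=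
  ∃ (n : ℕ) (a : Fin n → E) (lam : Fin n → ℝ),
    C.IsContextFun a ∧ Set.range a = A ∧ C.SpanRep a lam b

/-- `E` is spectral. -/
def Spectral (C : COSEA E) : Prop :=
  C.StateUnique ∧ ∀ b, ∃ A, C.IsContext A ∧ C.InSpan A b

/-- The commutant of a subset. -/
def commutant (C : COSEA E) (F : Set E) : Set E :=
  {b | ∀ a ∈ F, C.seq b a = C.seq a b}

/-- The center `E' = {b : b ∘ a = a ∘ b for all a}`. -/
def center (C : COSEA E) : Set E := C.commutant Set.univ

/-- `E` is a factor: the center consists of the effects `λ 1`, `λ ∈ [0,1]`. -/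
def IsFactor (C : COSEA E) : Prop :=
  C.center = {b | ∃ lam : ℝ, 0 ≤ lam ∧ lam ≤ 1 ∧ b = C.smul lam C.one}

/-- Sub-COSEA. -/
def IsSubCOSEA (C : COSEA E) (F : Set E) : Prop :=
  C.zero ∈ F ∧ C.one ∈ F ∧ (∀ a ∈ F, C.compl a ∈ F) ∧
    (∀ lam : ℝ, 0 ≤ lam → lam ≤ 1 → ∀ a ∈ F, C.smul lam a ∈ F) ∧
    (∀ a ∈ F, ∀ b ∈ F, C.perp a b → C.oplus a b ∈ F) ∧
    (∀ a ∈ F, ∀ b ∈ F, C.seq a b ∈ F)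

/-- `a` is a minimal sharp element of `F`. -/
def MinSharp (C : COSEA E) (F : Set E) (a : E) : Prop :=
  a ∈ F ∧ C.IsSharp a ∧ a ≠ C.zero ∧
    ∀ b ∈ F, C.IsSharp b → b ≠ C.zero → C.le b a → b = a

/-- COSEA isomorphism. -/
def IsIso {F : Type u} (C : COSEA E) (D : COSEA F) (φ : E → F) : Prop :=
  Function.Bijective φ ∧ φ C.one = D.one ∧
    (∀ a b, C.perp a b ↔ D.perp (φ a) (φ b)) ∧
    (∀ a b, C.perp a b → φ (C.oplus a b) = D.oplus (φ a) (φ b)) ∧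
    (∀ lam : ℝ, 0 ≤ lam → lam ≤ 1 → ∀ a, φ (C.smul lam a) = D.smul lam (φ a)) ∧
    (∀ a b, φ (C.seq a b) = D.seq (φ a) (φ b))

/-- `lam` is an eigenvalue of `b` : `lam = â(b)` for some eigeneffect `a` of `b`. -/
def IsEigenvalue (C : COSEA E) (b : E) (lam : ℝ) : Prop :=
  ∃ (a : E) (ω : E → ℝ), C.IsOneDim a ∧ C.seq a b = C.seq b a ∧
    C.IsState ω ∧ ω a = 1 ∧ lam = ω b

/-- The spectrum of `b`. -/
def spectrum (C : COSEA E) (b : E) : Set ℝ := {lam | C.IsEigenvalue b lam}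

/-- `c = ⌈a⌉` : `c` is the least sharp element dominating `a`. -/
def IsCeil (C : COSEA E) (a c : E) : Prop :=
  C.IsSharp c ∧ C.le a c ∧ ∀ d, C.IsSharp d → C.le a d → C.le c d

/-- `b` is a pseudo-inverse of `a` with scalar `lam` :
`⌈b⌉ = ⌈a⌉`, `‖b‖ = 1` and `a ∘ b = b ∘ a = lam ⌈a⌉`. -/
def IsPseudoInvWith (C : COSEA E) (a b : E) (lam : ℝ) : Prop :=
  (∃ ca, C.IsCeil a ca ∧ C.IsCeil b ca ∧
    C.seq a b = C.smul lam ca ∧ C.seq b a = C.smul lam ca) ∧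
  IsGreatest (C.spectrum b) 1 ∧ 0 ≤ lam ∧ lam ≤ 1

/-- The conditional probability map `γ_a` (zero functionals are sent to `0`). -/
noncomputable def condProb (C : COSEA E) (a : E) (ω : E → ℝ) : E → ℝ :=
  fun c => if ω a = 0 then 0 else ω (C.seq a c) / ω a

/-- Membership in `Ω̂(E) = Ω(E) ∪ {0}`. -/
def InOmegaHat (C : COSEA E) (ω : E → ℝ) : Prop :=
  C.IsState ω ∨ ω = fun _ => 0

/-- Direct sum of two COSEAs, with all operations componentwise. -/
def prod {E F : Type u} (C : COSEA E) (D : COSEA F) : COSEA (E × F) where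
  zero := (C.zero, D.zero)
  one := (C.one, D.one)
  perp a b := C.perp a.1 b.1 ∧ D.perp a.2 b.2
  oplus a b := (C.oplus a.1 b.1, D.oplus a.2 b.2)
  compl a := (C.compl a.1, D.compl a.2)
  smul lam a := (C.smul lam a.1, D.smul lam a.2)
  seq a b := (C.seq a.1 b.1, D.seq a.2 b.2)
  perp_comm := fun a b h => ⟨C.perp_comm _ _ h.1, D.perp_comm _ _ h.2⟩
  oplus_comm := fun a b h => prod_eq' (C.oplus_comm _ _ h.1) (D.oplus_comm _ _ h.2)
  perp_assoc_right := fun a b c h1 h2 =>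
    ⟨C.perp_assoc_right _ _ _ h1.1 h2.1, D.perp_assoc_right _ _ _ h1.2 h2.2⟩
  perp_assoc_left := fun a b c h1 h2 =>
    ⟨C.perp_assoc_left _ _ _ h1.1 h2.1, D.perp_assoc_left _ _ _ h1.2 h2.2⟩
  oplus_assoc := fun a b c h1 h2 =>
    prod_eq' (C.oplus_assoc _ _ _ h1.1 h2.1) (D.oplus_assoc _ _ _ h1.2 h2.2)
  perp_compl := fun a => ⟨C.perp_compl _, D.perp_compl _⟩
  oplus_compl := fun a => prod_eq' (C.oplus_compl _) (D.oplus_compl _)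
  compl_unique := fun a b h he =>
    prod_eq' (C.compl_unique _ _ h.1 (congrArg Prod.fst he))
      (D.compl_unique _ _ h.2 (congrArg Prod.snd he))
  perp_one := fun a h => prod_eq' (C.perp_one _ h.1) (D.perp_one _ h.2)
  smul_smul := fun α β a h1 h2 h3 h4 =>
    prod_eq' (C.smul_smul _ _ _ h1 h2 h3 h4) (D.smul_smul _ _ _ h1 h2 h3 h4)
  perp_smul_self := fun α β a h1 h2 h3 =>
    ⟨C.perp_smul_self _ _ _ h1 h2 h3, D.perp_smul_self _ _ _ h1 h2 h3⟩
  add_smul := fun α β a h1 h2 h3 =>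
    prod_eq' (C.add_smul _ _ _ h1 h2 h3) (D.add_smul _ _ _ h1 h2 h3)
  perp_smul := fun lam a b h1 h2 h =>
    ⟨C.perp_smul _ _ _ h1 h2 h.1, D.perp_smul _ _ _ h1 h2 h.2⟩
  smul_oplus := fun lam a b h1 h2 h =>
    prod_eq' (C.smul_oplus _ _ _ h1 h2 h.1) (D.smul_oplus _ _ _ h1 h2 h.2)
  one_smul := fun a => prod_eq' (C.one_smul _) (D.one_smul _)
  seq_perp := fun a b c h => ⟨C.seq_perp _ _ _ h.1, D.seq_perp _ _ _ h.2⟩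
  seq_oplus := fun a b c h => prod_eq' (C.seq_oplus _ _ _ h.1) (D.seq_oplus _ _ _ h.2)
  one_seq := fun a => prod_eq' (C.one_seq _) (D.one_seq _)
  seq_eq_zero_comm := fun a b h =>
    prod_eq' (C.seq_eq_zero_comm _ _ (congrArg Prod.fst h))
      (D.seq_eq_zero_comm _ _ (congrArg Prod.snd h))
  comm_compl := fun a b h =>
    prod_eq' (C.comm_compl _ _ (congrArg Prod.fst h))
      (D.comm_compl _ _ (congrArg Prod.snd h))
  comm_assoc := fun a b c h =>
    prod_eq' (C.comm_assoc _ _ _ (congrArg Prod.fst h))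
      (D.comm_assoc _ _ _ (congrArg Prod.snd h))
  comm_seq := fun a b c h1 h2 =>
    prod_eq' (C.comm_seq _ _ _ (congrArg Prod.fst h1) (congrArg Prod.fst h2))
      (D.comm_seq _ _ _ (congrArg Prod.snd h1) (congrArg Prod.snd h2))
  comm_oplus := fun a b c h1 h2 hp =>
    prod_eq' (C.comm_oplus _ _ _ (congrArg Prod.fst h1) (congrArg Prod.fst h2) hp.1)
      (D.comm_oplus _ _ _ (congrArg Prod.snd h1) (congrArg Prod.snd h2) hp.2)
  smul_seq := fun lam a b h1 h2 =>
    prod_eq' (C.smul_seq _ _ _ h1 h2) (D.smul_seq _ _ _ h1 h2)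
  seq_smul := fun lam a b h1 h2 =>
    prod_eq' (C.seq_smul _ _ _ h1 h2) (D.seq_smul _ _ _ h1 h2)

/-- Direct sum of a family of COSEAs, with all operations componentwise. -/
def pi {ι : Type v} {E : ι → Type u} (C : ∀ i, COSEA (E i)) : COSEA (∀ i, E i) where
  zero := fun i => (C i).zero
  one := fun i => (C i).one
  perp a b := ∀ i, (C i).perp (a i) (b i)
  oplus a b := fun i => (C i).oplus (a i) (b i)
  compl a := fun i => (C i).compl (a i)
  smul lam a := fun i => (C i).smul lam (a i)
  seq a b := fun i => (C i).seq (a i) (b i)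
  perp_comm := fun a b h i => (C i).perp_comm _ _ (h i)
  oplus_comm := fun a b h => funext fun i => (C i).oplus_comm _ _ (h i)
  perp_assoc_right := fun a b c h1 h2 i => (C i).perp_assoc_right _ _ _ (h1 i) (h2 i)
  perp_assoc_left := fun a b c h1 h2 i => (C i).perp_assoc_left _ _ _ (h1 i) (h2 i)
  oplus_assoc := fun a b c h1 h2 => funext fun i => (C i).oplus_assoc _ _ _ (h1 i) (h2 i)
  perp_compl := fun a i => (C i).perp_compl _
  oplus_compl := fun a => funext fun i => (C i).oplus_compl _
  compl_unique := fun a b h he =>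
    funext fun i => (C i).compl_unique _ _ (h i) (congrFun he i)
  perp_one := fun a h => funext fun i => (C i).perp_one _ (h i)
  smul_smul := fun α β a h1 h2 h3 h4 =>
    funext fun i => (C i).smul_smul _ _ _ h1 h2 h3 h4
  perp_smul_self := fun α β a h1 h2 h3 i => (C i).perp_smul_self _ _ _ h1 h2 h3
  add_smul := fun α β a h1 h2 h3 => funext fun i => (C i).add_smul _ _ _ h1 h2 h3
  perp_smul := fun lam a b h1 h2 h i => (C i).perp_smul _ _ _ h1 h2 (h i)
  smul_oplus := fun lam a b h1 h2 h =>
    funext fun i => (C i).smul_oplus _ _ _ h1 h2 (h i)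
  one_smul := fun a => funext fun i => (C i).one_smul _
  seq_perp := fun a b c h i => (C i).seq_perp _ _ _ (h i)
  seq_oplus := fun a b c h => funext fun i => (C i).seq_oplus _ _ _ (h i)
  one_seq := fun a => funext fun i => (C i).one_seq _
  seq_eq_zero_comm := fun a b h =>
    funext fun i => (C i).seq_eq_zero_comm _ _ (congrFun h i)
  comm_compl := fun a b h => funext fun i => (C i).comm_compl _ _ (congrFun h i)
  comm_assoc := fun a b c h => funext fun i => (C i).comm_assoc _ _ _ (congrFun h i)
  comm_seq := fun a b c h1 h2 =>
    funext fun i => (C i).comm_seq _ _ _ (congrFun h1 i) (congrFun h2 i)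
  comm_oplus := fun a b c h1 h2 hp =>
    funext fun i => (C i).comm_oplus _ _ _ (congrFun h1 i) (congrFun h2 i) (hp i)
  smul_seq := fun lam a b h1 h2 => funext fun i => (C i).smul_seq _ _ _ h1 h2
  seq_smul := fun lam a b h1 h2 => funext fun i => (C i).seq_smul _ _ _ h1 h2

end COSEA

namespace COSEA

variable {E : Type u}

/-- The effects together with one extra point, the value of an undefined orthogonal sum. -/
def Ext (_ : COSEA E) : Type u := Option E

/-- The inclusion of the effects into `C.Ext`. -/
def of (C : COSEA E) (a : E) : C.Ext := some a

/-- The value of an undefined orthogonal sum. -/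
def undef (C : COSEA E) : C.Ext := (none : Option E)

theorem of_injective (C : COSEA E) : Function.Injective C.of := Option.some_injective E

theorem zero_eq_compl_one (C : COSEA E) : C.compl C.one = C.zero :=
  C.perp_one _ (C.perp_comm _ _ (C.perp_compl _))

theorem compl_compl (C : COSEA E) (a : E) : C.compl (C.compl a) = a := by
  have h := C.perp_compl a
  refine (C.compl_unique _ _ (C.perp_comm _ _ h) ?_).symm
  rw [← C.oplus_comm _ _ h, C.oplus_compl]

theorem perp_one_zero (C : COSEA E) : C.perp C.one C.zero :=
  C.zero_eq_compl_one ▸ C.perp_compl C.one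

theorem oplus_one_zero (C : COSEA E) : C.oplus C.one C.zero = C.one := by
  conv_lhs => rw [← C.zero_eq_compl_one]
  exact C.oplus_compl _

theorem perp_zero (C : COSEA E) (a : E) : C.perp a C.zero := by
  have h := C.perp_comm _ _ (C.perp_compl a)
  refine C.perp_assoc_right _ _ _ h ?_
  rw [← C.oplus_comm _ _ (C.perp_compl a), C.oplus_compl]
  exact C.perp_one_zero

theorem oplus_zero (C : COSEA E) (a : E) : C.oplus a C.zero = a := by
  have h := C.perp_comm _ _ (C.perp_compl a)
  have h1 : C.oplus (C.compl a) a = C.one := by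
    rw [← C.oplus_comm _ _ (C.perp_compl a), C.oplus_compl]
  have h2 : C.perp (C.oplus (C.compl a) a) C.zero := h1 ▸ C.perp_one_zero
  have h3 := C.compl_unique _ _ (C.perp_assoc_left _ _ _ h h2)
    (by rw [C.oplus_assoc _ _ _ h h2, h1, C.oplus_one_zero])
  rw [h3, C.compl_compl]

open Classical in
noncomputable instance (C : COSEA E) : Add C.Ext where
  add x y := x.bind fun a => y.bind fun b => if C.perp a b then some (C.oplus a b) else none

theorem add_undef (C : COSEA E) (x : C.Ext) : x + C.undef = C.undef := by
  cases x <;> rfl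

theorem of_add_of (C : COSEA E) {a b : E} (h : C.perp a b) :
    C.of a + C.of b = C.of (C.oplus a b) :=
  if_pos h

theorem of_add_of_not_perp (C : COSEA E) {a b : E} (h : ¬ C.perp a b) :
    C.of a + C.of b = C.undef :=
  if_neg h

theorem of_add_of_eq_iff (C : COSEA E) {a b s : E} :
    C.of a + C.of b = C.of s ↔ C.perp a b ∧ C.oplus a b = s := by
  by_cases h : C.perp a b
  · rw [C.of_add_of h, C.of_injective.eq_iff]
    simp [h]
  · rw [C.of_add_of_not_perp h]
    simp only [h, false_and, iff_false]
    exact Option.some_ne_none s ∘ Eq.symm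

theorem exists_of_add_eq (C : COSEA E) {x y : C.Ext} {s : E} (h : x + y = C.of s) :
    ∃ a b, x = C.of a ∧ y = C.of b := by
  rcases x with _ | a
  · exact absurd h.symm (Option.some_ne_none s)
  · rcases y with _ | b
    · exact absurd h.symm (Option.some_ne_none s)
    · exact ⟨a, b, rfl, rfl⟩

theorem ext_add_comm (C : COSEA E) (x y : C.Ext) : x + y = y + x := by
  rcases x with _ | a
  · exact (C.add_undef y).symm
  rcases y with _ | b
  · rfl
  change C.of a + C.of b = C.of b + C.of a
  by_cases h : C.perp a b
  · rw [C.of_add_of h, C.of_add_of (C.perp_comm _ _ h), C.oplus_comm _ _ h]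
  · rw [C.of_add_of_not_perp h, C.of_add_of_not_perp fun h' => h (C.perp_comm _ _ h')]

theorem ext_add_assoc_of_eq (C : COSEA E) {x y z : C.Ext} {s : E} (h : x + y + z = C.of s) :
    x + (y + z) = C.of s := by
  obtain ⟨t, c, ht, rfl⟩ := C.exists_of_add_eq h
  obtain ⟨a, b, rfl, rfl⟩ := C.exists_of_add_eq ht
  obtain ⟨h1, rfl⟩ := C.of_add_of_eq_iff.1 ht
  rw [C.of_add_of h1] at h
  obtain ⟨h2, rfl⟩ := C.of_add_of_eq_iff.1 h
  rw [C.of_add_of (C.perp_assoc_right _ _ _ h1 h2), C.of_add_of (C.perp_assoc_left _ _ _ h1 h2),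
    C.oplus_assoc _ _ _ h1 h2]

instance (C : COSEA E) : Zero C.Ext where
  zero := C.of C.zero

noncomputable instance (C : COSEA E) : AddCommMonoid C.Ext where
  add_comm := C.ext_add_comm
  zero_add x := by
    rcases x with _ | a
    · rfl
    · change C.of C.zero + C.of a = C.of a
      rw [C.ext_add_comm, C.of_add_of (C.perp_zero a), C.oplus_zero]
  add_zero x := by
    rcases x with _ | a
    · rfl
    · change C.of a + C.of C.zero = C.of a
      rw [C.of_add_of (C.perp_zero a), C.oplus_zero]
  add_assoc x y z := by
    rcases h : x + y + z with _ | s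
    · rcases h' : x + (y + z) with _ | t
      · rfl
      · rw [C.ext_add_comm, C.ext_add_comm y] at h'
        have := C.ext_add_assoc_of_eq h'
        rw [C.ext_add_comm, C.ext_add_comm y, h] at this
        exact absurd this.symm (Option.some_ne_none t)
    · exact (C.ext_add_assoc_of_eq h).symm
  nsmul := nsmulRec

theorem of_zero (C : COSEA E) : C.of C.zero = 0 := rfl

theorem sumList_iff (C : COSEA E) {l : List E} {s : E} :
    C.SumList l s ↔ (l.map C.of).sum = C.of s := by
  induction l generalizing s with
  | nil =>
    simp only [List.map_nil, List.sum_nil, ← C.of_zero, C.of_injective.eq_iff]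
    exact ⟨fun h => by cases h; rfl, fun h => h ▸ SumList.nil⟩
  | cons a l ih =>
    rw [List.map_cons, List.sum_cons]
    constructor
    · rintro (_ | ⟨h, hp⟩)
      rw [ih.1 h, C.of_add_of hp]
    · intro h
      obtain ⟨_, t, -, ht⟩ := C.exists_of_add_eq h
      rw [ht] at h
      obtain ⟨hp, rfl⟩ := C.of_add_of_eq_iff.1 h
      exact SumList.cons (ih.2 ht) hp

theorem sumList_ofFn_iff (C : COSEA E) {n : ℕ} {f : Fin n → E} {s : E} :
    C.SumList (List.ofFn f) s ↔ ∑ i, C.of (f i) = C.of s := by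
  rw [C.sumList_iff, List.map_ofFn, List.sum_ofFn]
  rfl

theorem le_iff (C : COSEA E) {a b : E} : C.le a b ↔ ∃ c, C.of a + C.of c = C.of b := by
  simp only [le, C.of_add_of_eq_iff]

theorem exists_of_sum_eq (C : COSEA E) {ι : Type*} [Fintype ι] {f : ι → C.Ext} {s : E}
    (h : ∑ i, f i = C.of s) (T : Finset ι) : ∃ t, ∑ i ∈ T, f i = C.of t ∧ C.le t s := by
  classical
  rw [← Finset.sum_add_sum_compl T] at h
  obtain ⟨t, t', ht, ht'⟩ := C.exists_of_add_eq h
  rw [ht, ht'] at h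
  exact ⟨t, ht, C.le_iff.2 ⟨t', h⟩⟩

theorem of_add_compl (C : COSEA E) (a : E) : C.of a + C.of (C.compl a) = C.of C.one :=
  C.of_add_of_eq_iff.2 ⟨C.perp_compl a, C.oplus_compl a⟩

theorem eq_compl_of_add (C : COSEA E) {a b : E} (h : C.of a + C.of b = C.of C.one) :
    b = C.compl a :=
  C.compl_unique _ _ (C.of_add_of_eq_iff.1 h).1 (C.of_add_of_eq_iff.1 h).2

theorem of_add_cancel (C : COSEA E) {a b c s : E} (h1 : C.of a + C.of b = C.of s)
    (h2 : C.of a + C.of c = C.of s) : b = c := by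
  have key : ∀ d, C.of a + C.of d = C.of s →
      C.of (C.compl s) + C.of a + C.of d = C.of C.one := fun d hd => by
    rw [add_assoc, hd, add_comm, C.of_add_compl]
  obtain ⟨e, _, he, -⟩ := C.exists_of_add_eq (key b h1)
  have hb := key b h1
  have hc := key c h2
  rw [he] at hb hc
  rw [C.eq_compl_of_add hb, C.eq_compl_of_add hc]

theorem eq_zero_of_add_eq_self (C : COSEA E) {a b : E} (h : C.of a + C.of b = C.of a) :
    b = C.zero :=
  C.of_add_cancel h (add_zero _)

theorem eq_zero_of_add_eq_zero (C : COSEA E) {a b : E} (h : C.of a + C.of b = C.of C.zero) :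
    b = C.zero := by
  have h1 : C.of a + C.of b + C.of C.one = C.of C.one := by rw [h, C.of_zero, zero_add]
  rw [add_assoc] at h1
  obtain ⟨_, t, -, ht⟩ := C.exists_of_add_eq h1
  exact C.perp_one _ (C.of_add_of_eq_iff.1 ht).1

theorem eq_zero_of_le_zero (C : COSEA E) {a : E} (h : C.le a C.zero) : a = C.zero := by
  obtain ⟨c, hc⟩ := C.le_iff.1 h
  exact C.eq_zero_of_add_eq_zero ((add_comm _ _).trans hc)

theorem le_trans (C : COSEA E) {a b c : E} (h1 : C.le a b) (h2 : C.le b c) : C.le a c := by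
  obtain ⟨x, hx⟩ := C.le_iff.1 h1
  obtain ⟨y, hy⟩ := C.le_iff.1 h2
  rw [← hx, add_assoc] at hy
  obtain ⟨_, t, -, ht⟩ := C.exists_of_add_eq hy
  exact C.le_iff.2 ⟨t, ht ▸ hy⟩

theorem le_compl_of_perp (C : COSEA E) {a b : E} (h : C.perp a b) : C.le b (C.compl a) := by
  have h1 := C.of_add_compl (C.oplus a b)
  rw [← C.of_add_of h, add_assoc] at h1
  obtain ⟨_, t, -, ht⟩ := C.exists_of_add_eq h1
  rw [ht] at h1
  exact C.le_iff.2 ⟨_, by rw [ht, C.eq_compl_of_add h1]⟩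

theorem sum_of_map (C : COSEA E) {T : E → E} (h0 : T C.zero = C.zero)
    (hT : ∀ a b, C.perp a b → C.of (T a) + C.of (T b) = C.of (T (C.oplus a b)))
    {ι : Type*} {S : Finset ι} {f : ι → E} {s : E} (h : ∑ i ∈ S, C.of (f i) = C.of s) :
    ∑ i ∈ S, C.of (T (f i)) = C.of (T s) := by
  classical
  induction S using Finset.induction_on generalizing s with
  | empty =>
    rw [Finset.sum_empty, ← C.of_zero, C.of_injective.eq_iff] at h
    rw [Finset.sum_empty, ← h, h0, C.of_zero]
  | insert i S hi ih =>
    rw [Finset.sum_insert hi] at h ⊢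
    obtain ⟨_, t, -, ht⟩ := C.exists_of_add_eq h
    rw [ht] at h
    obtain ⟨hp, rfl⟩ := C.of_add_of_eq_iff.1 h
    rw [ih ht, hT _ _ hp]

theorem sum_of_mem (C : COSEA E) {P : E → Prop} (h0 : P C.zero)
    (hP : ∀ a b, P a → P b → C.perp a b → P (C.oplus a b))
    {ι : Type*} {S : Finset ι} {f : ι → E} {s : E} (hf : ∀ i ∈ S, P (f i))
    (h : ∑ i ∈ S, C.of (f i) = C.of s) : P s := by
  classical
  induction S using Finset.induction_on generalizing s with
  | empty =>
    rw [Finset.sum_empty, ← C.of_zero, C.of_injective.eq_iff] at h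
    exact h ▸ h0
  | insert i S hi ih =>
    rw [Finset.sum_insert hi] at h
    obtain ⟨_, t, -, ht⟩ := C.exists_of_add_eq h
    rw [ht] at h
    obtain ⟨hp, rfl⟩ := C.of_add_of_eq_iff.1 h
    exact hP _ _ (hf i (Finset.mem_insert_self _ _))
      (ih (fun j hj => hf j (Finset.mem_insert_of_mem hj)) ht) hp

/-! ### Scalars -/

theorem of_add_smul (C : COSEA E) {r t : ℝ} (a : E) (hr : 0 ≤ r) (ht : 0 ≤ t) (h : r + t ≤ 1) :
    C.of (C.smul r a) + C.of (C.smul t a) = C.of (C.smul (r + t) a) := by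
  rw [C.of_add_of (C.perp_smul_self _ _ _ hr ht h), C.add_smul _ _ _ hr ht h]

theorem zero_smul (C : COSEA E) (a : E) : C.smul 0 a = C.zero := by
  refine C.eq_zero_of_add_eq_self (a := C.smul 0 a) ?_
  rw [C.of_add_smul a le_rfl le_rfl (by norm_num), add_zero]

theorem smul_zero (C : COSEA E) {r : ℝ} (h0 : 0 ≤ r) (h1 : r ≤ 1) :
    C.smul r C.zero = C.zero := by
  refine C.eq_zero_of_add_eq_self (a := C.smul r C.zero) ?_
  have hp := C.perp_zero C.zero
  rw [C.of_add_of (C.perp_smul _ _ _ h0 h1 hp), ← C.smul_oplus _ _ _ h0 h1 hp, C.oplus_zero]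

theorem nsmul_of_smul (C : COSEA E) {t : ℝ} (a : E) (ht : 0 ≤ t) (k : ℕ) (hk : k * t ≤ 1) :
    k • C.of (C.smul t a) = C.of (C.smul (k * t) a) := by
  induction k with
  | zero => rw [zero_nsmul, Nat.cast_zero, zero_mul, C.zero_smul, C.of_zero]
  | succ k ih =>
    push_cast at hk ⊢
    have hk' : (k : ℝ) * t + t ≤ 1 := by linarith
    rw [succ_nsmul, ih (by linarith), C.of_add_smul a (by positivity) ht hk', add_one_mul]

theorem exists_nsmul_of_smul_smul (C : COSEA E) {r : ℝ} (h0 : 0 < r) (h1 : r ≤ 1) :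
    ∃ (t : ℝ) (N : ℕ), 0 ≤ t ∧ t ≤ 1 ∧
      ∀ a, N • C.of (C.smul t (C.smul r a)) = C.of a := by
  obtain ⟨N, hN⟩ := exists_nat_gt (1 / r)
  have hN0 : (0 : ℝ) < N := lt_trans (by positivity) hN
  have hNr : 1 ≤ N * r := by
    rw [div_lt_iff₀ h0] at hN
    exact hN.le
  have hle : 1 / (N * r) ≤ 1 := by rw [div_le_one (by positivity)]; exact hNr
  refine ⟨1 / (N * r), N, by positivity, hle, fun a => ?_⟩
  rw [C.smul_smul _ _ _ (by positivity) hle h0.le h1]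
  have h : (N : ℝ) * (1 / (N * r) * r) = 1 := by field_simp
  rw [C.nsmul_of_smul a (by positivity) N h.le, h, C.one_smul]

theorem smul_cancel (C : COSEA E) {r : ℝ} {a b : E} (h0 : 0 < r) (h1 : r ≤ 1)
    (h : C.smul r a = C.smul r b) : a = b := by
  obtain ⟨t, N, -, -, hN⟩ := C.exists_nsmul_of_smul_smul h0 h1
  apply C.of_injective
  rw [← hN a, ← hN b, h]

theorem eq_zero_of_smul_eq_zero (C : COSEA E) {r : ℝ} {a : E} (h0 : 0 < r) (h1 : r ≤ 1)
    (h : C.smul r a = C.zero) : a = C.zero :=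
  C.smul_cancel h0 h1 (by rw [h, C.smul_zero h0.le h1])

theorem smul_le (C : COSEA E) {r : ℝ} (a : E) (h0 : 0 ≤ r) (h1 : r ≤ 1) :
    C.le (C.smul r a) a := by
  refine C.le_iff.2 ⟨C.smul (1 - r) a, ?_⟩
  rw [C.of_add_smul a h0 (by linarith) (by linarith), add_sub_cancel, C.one_smul]

/-! ### The sequential product and sharp elements -/

theorem of_seq_add (C : COSEA E) (a : E) {b c s : E} (h : C.of b + C.of c = C.of s) :
    C.of (C.seq a b) + C.of (C.seq a c) = C.of (C.seq a s) := by
  obtain ⟨hp, rfl⟩ := C.of_add_of_eq_iff.1 h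
  rw [C.of_add_of (C.seq_perp _ _ _ hp), C.seq_oplus _ _ _ hp]

theorem seq_zero (C : COSEA E) (a : E) : C.seq a C.zero = C.zero :=
  C.eq_zero_of_add_eq_self (C.of_seq_add a (add_zero (C.of C.zero)))

theorem zero_seq (C : COSEA E) (a : E) : C.seq C.zero a = C.zero := by
  rw [C.seq_eq_zero_comm _ _ (C.seq_zero a), C.seq_zero]

theorem seq_one (C : COSEA E) (a : E) : C.seq a C.one = a := by
  have h := C.comm_compl a C.zero (by rw [C.seq_zero, C.zero_seq])
  rwa [← C.zero_eq_compl_one, C.compl_compl, C.one_seq] at h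

theorem seq_sum (C : COSEA E) (a : E) {ι : Type*} {S : Finset ι} {f : ι → E} {s : E}
    (h : ∑ i ∈ S, C.of (f i) = C.of s) :
    ∑ i ∈ S, C.of (C.seq a (f i)) = C.of (C.seq a s) :=
  C.sum_of_map (T := C.seq a) (C.seq_zero a)
    (fun _ _ hp => C.of_seq_add a (C.of_add_of hp)) h

theorem comm_sum (C : COSEA E) {c : E} {ι : Type*} {S : Finset ι} {f : ι → E} {s : E}
    (hf : ∀ i ∈ S, C.seq c (f i) = C.seq (f i) c) (h : ∑ i ∈ S, C.of (f i) = C.of s) :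
    C.seq c s = C.seq s c :=
  C.sum_of_mem (P := fun x => C.seq c x = C.seq x c) (by rw [C.seq_zero, C.zero_seq])
    (fun a b ha hb hp => C.comm_oplus a b c ha hb hp) hf h

theorem seq_le_seq (C : COSEA E) (a : E) {b c : E} (h : C.le b c) :
    C.le (C.seq a b) (C.seq a c) := by
  obtain ⟨d, hd⟩ := C.le_iff.1 h
  exact C.le_iff.2 ⟨_, C.of_seq_add a hd⟩

theorem seq_le_left (C : COSEA E) (a b : E) : C.le (C.seq a b) a := by
  conv_rhs => rw [← C.seq_one a]
  exact C.seq_le_seq a (C.le_iff.2 ⟨_, C.of_add_compl b⟩)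

theorem seq_compl_eq_zero_iff (C : COSEA E) {a b : E} :
    C.seq b (C.compl a) = C.zero ↔ C.seq b a = b := by
  have h := C.of_seq_add b (C.of_add_compl a)
  rw [C.seq_one] at h
  constructor <;> intro h'
  · rw [h', C.of_zero, add_zero] at h
    exact C.of_injective h
  · rw [h'] at h
    exact C.eq_zero_of_add_eq_self h

theorem isSharp_iff (C : COSEA E) {a : E} : C.IsSharp a ↔ C.seq a a = a := by
  have hc : C.seq a (C.compl a) = C.seq (C.compl a) a := C.comm_compl a a rfl
  rw [← C.seq_compl_eq_zero_iff]
  constructor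
  · intro h
    exact C.eq_zero_of_le_zero (h _ (C.seq_le_left _ _) (hc ▸ C.seq_le_left _ _))
  · intro h c h1 h2
    have h3 : C.seq a c = C.zero := C.eq_zero_of_le_zero (h ▸ C.seq_le_seq a h2)
    have h4 : C.seq (C.compl a) c = C.zero :=
      C.eq_zero_of_le_zero ((hc.symm.trans h) ▸ C.seq_le_seq (C.compl a) h1)
    have h5 := C.seq_eq_zero_comm _ _ h3
    have h6 := C.seq_eq_zero_comm _ _ h4
    rw [h3] at h5
    rw [h4, C.seq_compl_eq_zero_iff, h5] at h6
    rw [← h6]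
    exact C.le_iff.2 ⟨C.zero, add_zero _⟩

theorem IsSharp.compl {C : COSEA E} {a : E} (h : C.IsSharp a) : C.IsSharp (C.compl a) := by
  intro c h1 h2
  rw [C.compl_compl] at h2
  exact h c h2 h1

theorem IsSharp.seq_eq_of_le {C : COSEA E} {a b : E} (ha : C.IsSharp a) (h : C.le b a) :
    C.seq a b = b ∧ C.seq b a = b := by
  have h1 : C.seq (C.compl a) a = C.zero := by
    rw [← C.comm_compl a a rfl, C.seq_compl_eq_zero_iff, ← C.isSharp_iff]
    exact ha
  have h2 : C.seq (C.compl a) b = C.zero := C.eq_zero_of_le_zero (h1 ▸ C.seq_le_seq _ h)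
  have h3 := C.seq_eq_zero_comm _ _ h2
  have h4 := C.comm_compl b (C.compl a) h3
  rw [C.compl_compl] at h4
  have h5 := C.seq_compl_eq_zero_iff.1 (h3.trans h2)
  exact ⟨h4.symm.trans h5, h5⟩

theorem IsSharp.le_of_smul_le {C : COSEA E} {a b : E} {r : ℝ} (ha : C.IsSharp a) (h0 : 0 < r)
    (h1 : r ≤ 1) (h : C.le (C.smul r b) a) : C.le b a := by
  have h2 := (ha.seq_eq_of_le h).1
  rw [C.seq_smul _ _ _ h0.le h1] at h2
  rw [← C.smul_cancel h0 h1 h2]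
  exact C.seq_le_left _ _

theorem IsSharp.seq_eq_zero_of_perp {C : COSEA E} {a b : E} (ha : C.IsSharp a)
    (h : C.perp a b) : C.seq a b = C.zero ∧ C.seq b a = C.zero := by
  have h1 := (ha.compl.seq_eq_of_le (C.le_compl_of_perp h)).2
  rw [← C.seq_compl_eq_zero_iff, C.compl_compl] at h1
  exact ⟨(C.seq_eq_zero_comm _ _ h1).trans h1, h1⟩

theorem IsSharp.oplus {C : COSEA E} {a b : E} (ha : C.IsSharp a) (hb : C.IsSharp b)
    (h : C.perp a b) : C.IsSharp (C.oplus a b) := by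
  obtain ⟨hab, hba⟩ := ha.seq_eq_zero_of_perp h
  have hs := C.of_add_of h
  have h1 : C.seq a (C.oplus a b) = a := by
    apply C.of_injective
    rw [← C.of_seq_add a hs, hab, C.isSharp_iff.1 ha, C.of_zero, add_zero]
  have h2 : C.seq b (C.oplus a b) = b := by
    apply C.of_injective
    rw [← C.of_seq_add b hs, hba, C.isSharp_iff.1 hb, C.of_zero, zero_add]
  rw [C.isSharp_iff]
  apply C.of_injective
  rw [← C.of_seq_add _ hs, ← C.comm_oplus a b a rfl (hab.trans hba.symm) h,
    ← C.comm_oplus a b b (hba.trans hab.symm) rfl h, h1, h2, hs]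

theorem eq_compl_oplus_of_add {C : COSEA E} {p q d : E} (h : C.of q + C.of d = C.of p) :
    C.perp (C.compl p) q ∧ d = C.compl (C.oplus (C.compl p) q) := by
  have h1 := C.of_add_compl p
  rw [← h, add_comm, ← add_assoc] at h1
  obtain ⟨t, _, ht, -⟩ := C.exists_of_add_eq h1
  obtain ⟨hp, rfl⟩ := C.of_add_of_eq_iff.1 ht
  rw [ht] at h1
  exact ⟨hp, C.eq_compl_of_add h1⟩

theorem IsSharp.of_add {C : COSEA E} {p q d : E} (hp : C.IsSharp p) (hq : C.IsSharp q)
    (h : C.of q + C.of d = C.of p) : C.IsSharp d := by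
  obtain ⟨hp', rfl⟩ := eq_compl_oplus_of_add h
  exact (hp.compl.oplus hq hp').compl

theorem IsSharp.eq_zero_of_perp_self {C : COSEA E} {a : E} (ha : C.IsSharp a)
    (h : C.perp a a) : a = C.zero :=
  (C.isSharp_iff.1 ha).symm.trans (ha.seq_eq_zero_of_perp h).1

theorem perp_of_sum (C : COSEA E) {ι : Type*} [Fintype ι] {a : ι → E} {s : E}
    (h : ∑ i, C.of (a i) = C.of s) {i j : ι} (hij : i ≠ j) : C.perp (a i) (a j) := by
  classical
  obtain ⟨t, ht, -⟩ := C.exists_of_sum_eq h {i, j}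
  rw [Finset.sum_pair hij] at ht
  exact (C.of_add_of_eq_iff.1 ht).1

theorem injective_of_sum (C : COSEA E) {ι : Type*} [Fintype ι] {a : ι → E} {s : E}
    (ha : ∀ i, C.IsSharp (a i)) (h0 : ∀ i, a i ≠ C.zero)
    (h : ∑ i, C.of (a i) = C.of s) : Function.Injective a := by
  intro i j hij
  by_contra hne
  have hp := C.perp_of_sum h hne
  rw [← hij] at hp
  exact h0 i ((ha i).eq_zero_of_perp_self hp)

/-! ### Combinations of a sharp resolution of the unit -/

/-- A finite orthogonal family of sharp elements with sum `1`. -/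
def IsResolution (C : COSEA E) {ι : Type*} [Fintype ι] (a : ι → E) : Prop :=
  (∀ i, C.IsSharp (a i)) ∧ ∑ i, C.of (a i) = C.of C.one

/-- `s` is the orthogonal sum of the `v i • a i`, with all `v i ∈ [0,1]`. -/
def Comb (C : COSEA E) {ι : Type*} [Fintype ι] (a : ι → E) (v : ι → ℝ) (s : E) : Prop :=
  (∀ i, 0 ≤ v i ∧ v i ≤ 1) ∧ ∑ i, C.of (C.smul (v i) (a i)) = C.of s

theorem spanRep_iff_comb (C : COSEA E) {n : ℕ} {a : Fin n → E} {v : Fin n → ℝ} {s : E} :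
    C.SpanRep a v s ↔ C.Comb a v s := by
  rw [SpanRep, Comb, C.sumList_ofFn_iff]

section Resolution

variable {C : COSEA E} {ι : Type*} [Fintype ι] {a : ι → E} {v w : ι → ℝ} {s t : E}

theorem Comb.unique (hs : C.Comb a v s) (ht : C.Comb a v t) : s = t :=
  C.of_injective (hs.2.symm.trans ht.2)

theorem comb_one (ha : C.IsResolution a) : C.Comb a (fun _ => 1) C.one :=
  ⟨fun _ => ⟨zero_le_one, le_rfl⟩, by simp only [C.one_smul, ha.2]⟩

theorem comb_zero : C.Comb a (fun _ => 0) C.zero :=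
  ⟨fun _ => ⟨le_rfl, zero_le_one⟩, by simp [C.zero_smul, C.of_zero]⟩

theorem sum_add_comb (hv : ∀ i, 0 ≤ v i) (hw : ∀ i, 0 ≤ w i) (h : ∀ i, v i + w i ≤ 1) :
    ∑ i, C.of (C.smul (v i) (a i)) + ∑ i, C.of (C.smul (w i) (a i)) =
      ∑ i, C.of (C.smul (v i + w i) (a i)) := by
  rw [← Finset.sum_add_distrib]
  exact Finset.sum_congr rfl fun i _ => C.of_add_smul _ (hv i) (hw i) (h i)

theorem IsResolution.exists_comb (ha : C.IsResolution a) (hv : ∀ i, 0 ≤ v i ∧ v i ≤ 1) :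
    ∃ s, C.Comb a v s := by
  have h := sum_add_comb (C := C) (a := a) (v := v) (w := fun i => 1 - v i)
    (fun i => (hv i).1) (fun i => sub_nonneg.2 (hv i).2) (fun i => by simp)
  simp only [add_sub_cancel, C.one_smul, ha.2] at h
  obtain ⟨s, _, hs, -⟩ := C.exists_of_add_eq h
  exact ⟨s, hv, hs⟩

theorem Comb.compl (ha : C.IsResolution a) (hs : C.Comb a v s) :
    C.Comb a (fun i => 1 - v i) (C.compl s) := by
  have hv : ∀ i, 0 ≤ 1 - v i ∧ 1 - v i ≤ 1 := fun i =>
    ⟨sub_nonneg.2 (hs.1 i).2, sub_le_self _ (hs.1 i).1⟩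
  obtain ⟨t, ht⟩ := ha.exists_comb hv
  have h := sum_add_comb (C := C) (a := a) (v := v) (w := fun i => 1 - v i)
    (fun i => (hs.1 i).1) (fun i => (hv i).1) (fun i => by simp)
  simp only [add_sub_cancel, C.one_smul, ha.2] at h
  rw [hs.2, ht.2] at h
  rwa [← C.eq_compl_of_add h]

theorem Comb.oplus (hs : C.Comb a v s) (ht : C.Comb a w t) (hp : C.perp s t)
    (h : ∀ i, v i + w i ≤ 1) : C.Comb a (fun i => v i + w i) (C.oplus s t) := by
  refine ⟨fun i => ⟨add_nonneg (hs.1 i).1 (ht.1 i).1, h i⟩, ?_⟩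
  rw [← sum_add_comb (fun i => (hs.1 i).1) (fun i => (ht.1 i).1) h, hs.2, ht.2, C.of_add_of hp]

theorem Comb.perp (ha : C.IsResolution a) (hs : C.Comb a v s) (ht : C.Comb a w t)
    (h : ∀ i, v i + w i ≤ 1) : C.perp s t := by
  obtain ⟨u, hu⟩ := ha.exists_comb (v := fun i => v i + w i)
    fun i => ⟨add_nonneg (hs.1 i).1 (ht.1 i).1, h i⟩
  have h1 := hu.2
  rw [← sum_add_comb (fun i => (hs.1 i).1) (fun i => (ht.1 i).1) h, hs.2, ht.2] at h1
  exact (C.of_add_of_eq_iff.1 h1).1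

theorem Comb.smul {r : ℝ} (h0 : 0 ≤ r) (h1 : r ≤ 1) (hs : C.Comb a v s) :
    C.Comb a (fun i => r * v i) (C.smul r s) := by
  refine ⟨fun i => ⟨mul_nonneg h0 (hs.1 i).1, mul_le_one₀ h1 (hs.1 i).1 (hs.1 i).2⟩, ?_⟩
  rw [← C.sum_of_map (T := C.smul r) (C.smul_zero h0 h1) (fun x y hp => by
    rw [C.of_add_of (C.perp_smul _ _ _ h0 h1 hp), C.smul_oplus _ _ _ h0 h1 hp]) hs.2]
  exact Finset.sum_congr rfl fun i _ => by
    rw [C.smul_smul _ _ _ h0 h1 (hs.1 i).1 (hs.1 i).2]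

theorem IsResolution.seq_of_ne (ha : C.IsResolution a) {i j : ι} (h : i ≠ j) :
    C.seq (a i) (a j) = C.zero :=
  ((ha.1 i).seq_eq_zero_of_perp (C.perp_of_sum ha.2 h)).1

theorem IsResolution.seq_comm (ha : C.IsResolution a) (i j : ι) :
    C.seq (a i) (a j) = C.seq (a j) (a i) := by
  by_cases h : i = j
  · rw [h]
  · rw [ha.seq_of_ne h, ha.seq_of_ne (Ne.symm h)]

theorem Comb.seq_left (ha : C.IsResolution a) (hs : C.Comb a v s) (i : ι) :
    C.seq (a i) s = C.smul (v i) (a i) := by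
  apply C.of_injective
  rw [← C.seq_sum (a i) hs.2, Finset.sum_eq_single_of_mem i (Finset.mem_univ i),
    C.seq_smul _ _ _ (hs.1 i).1 (hs.1 i).2, C.isSharp_iff.1 (ha.1 i)]
  intro j _ hj
  rw [C.seq_smul _ _ _ (hs.1 j).1 (hs.1 j).2, ha.seq_of_ne (Ne.symm hj),
    C.smul_zero (hs.1 j).1 (hs.1 j).2, C.of_zero]

theorem Comb.seq_right (ha : C.IsResolution a) (hs : C.Comb a v s) (i : ι) :
    C.seq s (a i) = C.smul (v i) (a i) := by
  rw [← hs.seq_left ha i]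
  refine (C.comm_sum (fun j _ => ?_) hs.2).symm
  rw [C.seq_smul _ _ _ (hs.1 j).1 (hs.1 j).2, C.smul_seq _ _ _ (hs.1 j).1 (hs.1 j).2,
    ha.seq_comm]

theorem Comb.seq (ha : C.IsResolution a) (hs : C.Comb a v s) (ht : C.Comb a w t) :
    C.Comb a (fun i => v i * w i) (C.seq s t) := by
  refine ⟨fun i => ⟨mul_nonneg (hs.1 i).1 (ht.1 i).1,
    mul_le_one₀ (hs.1 i).2 (ht.1 i).1 (ht.1 i).2⟩, ?_⟩
  rw [← C.seq_sum s ht.2]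
  refine Finset.sum_congr rfl fun i _ => ?_
  rw [C.seq_smul _ _ _ (ht.1 i).1 (ht.1 i).2, hs.seq_right ha,
    C.smul_smul _ _ _ (ht.1 i).1 (ht.1 i).2 (hs.1 i).1 (hs.1 i).2, mul_comm]

theorem Comb.add_le_one (ha : C.IsResolution a) (hs : C.Comb a v s) (ht : C.Comb a w t)
    (hp : C.perp s t) {i : ι} (hi : a i ≠ C.zero) : v i + w i ≤ 1 := by
  by_contra! hlt
  obtain ⟨hv0, hv1⟩ := hs.1 i
  obtain ⟨hw0, hw1⟩ := ht.1 i
  have h := C.of_seq_add (a i) (C.of_add_of hp)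
  rw [hs.seq_left ha, ht.seq_left ha] at h
  have hw : w i = (1 - v i) + (v i + w i - 1) := by ring
  rw [hw, ← C.of_add_smul (a i) (by linarith) (by linarith) (by linarith), ← add_assoc,
    C.of_add_smul (a i) hv0 (by linarith) (by linarith), add_sub_cancel, C.one_smul] at h
  have h1 := (ha.1 i) _ (C.smul_le (a i) (by linarith) (by linarith))
    (C.le_compl_of_perp (C.of_add_of_eq_iff.1 h).1)
  exact hi (C.eq_zero_of_smul_eq_zero (by linarith) (by linarith) (C.eq_zero_of_le_zero h1))

theorem Comb.smul_le (hs : C.Comb a v s) (i : ι) : C.le (C.smul (v i) (a i)) s := by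
  obtain ⟨t, ht, hle⟩ := C.exists_of_sum_eq hs.2 {i}
  rw [Finset.sum_singleton] at ht
  rwa [C.of_injective ht]

end Resolution

/-- The combinations of a resolution of the unit by nonzero sharp elements form a
commutative sub-COSEA. -/
theorem IsResolution.isSubCOSEA {C : COSEA E} {ι : Type*} [Fintype ι] {a : ι → E}
    (ha : C.IsResolution a) (h0 : ∀ i, a i ≠ C.zero) :
    C.IsSubCOSEA {b | ∃ v, C.Comb a v b} ∧
      ∀ x ∈ {b | ∃ v, C.Comb a v b}, ∀ y ∈ {b | ∃ v, C.Comb a v b},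
        C.seq x y = C.seq y x := by
  refine ⟨⟨⟨_, comb_zero⟩, ⟨_, comb_one ha⟩, ?_, ?_, ?_, ?_⟩, ?_⟩
  · rintro x ⟨v, hv⟩
    exact ⟨_, hv.compl ha⟩
  · rintro r hr0 hr1 x ⟨v, hv⟩
    exact ⟨_, hv.smul hr0 hr1⟩
  · rintro x ⟨v, hv⟩ y ⟨w, hw⟩ hp
    exact ⟨_, hv.oplus hw hp fun i => hv.add_le_one ha hw hp (h0 i)⟩
  · rintro x ⟨v, hv⟩ y ⟨w, hw⟩
    exact ⟨_, hv.seq ha hw⟩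
  · rintro x ⟨v, hv⟩ y ⟨w, hw⟩
    have h := hw.seq ha hv
    simp only [mul_comm] at h
    exact (hv.seq ha hw).unique (by simpa only [mul_comm] using h)

/-! ### Sub-COSEAs -/

section Sub

variable {C : COSEA E} {F : Set E}

theorem IsSubCOSEA.sum_mem (hF : C.IsSubCOSEA F) {ι : Type*} {S : Finset ι} {f : ι → E} {s : E}
    (hf : ∀ i ∈ S, f i ∈ F) (h : ∑ i ∈ S, C.of (f i) = C.of s) : s ∈ F :=
  C.sum_of_mem (P := (· ∈ F)) hF.1 (fun x y hx hy hp => hF.2.2.2.2.1 x hx y hy hp) hf h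

theorem IsSubCOSEA.mem_of_smul_mem (hF : C.IsSubCOSEA F) {r : ℝ} {x : E} (h0 : 0 < r)
    (h1 : r ≤ 1) (h : C.smul r x ∈ F) : x ∈ F := by
  obtain ⟨t, N, ht0, ht1, hN⟩ := C.exists_nsmul_of_smul_smul h0 h1
  refine hF.sum_mem (S := Finset.range N) (f := fun _ => C.smul t (C.smul r x))
    (fun _ _ => hF.2.2.2.1 t ht0 ht1 _ h) ?_
  rw [Finset.sum_const, Finset.card_range, hN]

theorem IsSubCOSEA.sub_mem (hF : C.IsSubCOSEA F) {p q d : E} (hp : p ∈ F) (hq : q ∈ F)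
    (h : C.of q + C.of d = C.of p) : d ∈ F := by
  obtain ⟨hp', rfl⟩ := eq_compl_oplus_of_add h
  exact hF.2.2.1 _ (hF.2.2.2.2.1 _ (hF.2.2.1 _ hp) _ hq hp')

variable {ι : Type*} [Fintype ι] {a : ι → E} {v : ι → ℝ} {s : E}

theorem IsSubCOSEA.exists_sq_sub (hF : C.IsSubCOSEA F) (ha : C.IsResolution a)
    (hs : C.Comb a v s) (hsF : s ∈ F) {c : ℝ} (hc0 : 0 ≤ c) (hc1 : c ≤ 1) :
    ∃ u ∈ F, C.Comb a (fun i => (v i - c) ^ 2 / 2) u := by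
  have ⟨_, hF1, _, hFs, hFo, hFm⟩ := hF
  have hx := (hs.seq ha hs).smul (r := 1 / 2) (by norm_num) (by norm_num)
  have hc2 : c ^ 2 / 2 ≤ 1 := by nlinarith
  have hy := (comb_one ha).smul (r := c ^ 2 / 2) (by positivity) hc2
  have hz := hs.smul hc0 hc1
  have hle : ∀ i, 1 / 2 * (v i * v i) + c ^ 2 / 2 * 1 ≤ 1 := fun i => by
    nlinarith [(hs.1 i).1, (hs.1 i).2]
  have hp := hx.perp ha hy hle
  have hxy := hx.oplus hy hp hle
  have hd : ∀ i, 0 ≤ (v i - c) ^ 2 / 2 ∧ (v i - c) ^ 2 / 2 ≤ 1 := fun i =>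
    ⟨by positivity, by nlinarith [(hs.1 i).1, (hs.1 i).2, mul_nonneg hc0 (hs.1 i).1]⟩
  obtain ⟨u, hu⟩ := ha.exists_comb hd
  have hsum : ∀ i, c * v i + (v i - c) ^ 2 / 2 = 1 / 2 * (v i * v i) + c ^ 2 / 2 * 1 :=
    fun i => by ring
  have hle' : ∀ i, c * v i + (v i - c) ^ 2 / 2 ≤ 1 := fun i => (hsum i).trans_le (hle i)
  have hp' := hz.perp ha hu hle'
  have hzu := hz.oplus hu hp' hle'
  simp only [hsum] at hzu
  refine ⟨u, hF.sub_mem (hFo _ (hFs _ (by norm_num) (by norm_num) _ (hFm _ hsF _ hsF)) _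
    (hFs _ (by positivity) hc2 _ hF1) hp) (hFs c hc0 hc1 _ hsF) ?_, hu⟩
  rw [C.of_add_of hp', hzu.unique hxy]

/-- A sub-COSEA contains the spectral projections of each of its elements. -/
theorem IsSubCOSEA.exists_projection (hF : C.IsSubCOSEA F) (ha : C.IsResolution a)
    (hs : C.Comb a v s) (hsF : s ∈ F) (m : ℝ) :
    ∃ e ∈ F, C.Comb a (fun i => if v i = m then 1 else 0) e := by
  classical
  have key : ∀ T : Finset ι, (∀ k ∈ T, v k ≠ m) →
      ∃ (w : ι → ℝ) (r : ℝ), 0 < r ∧ r ≤ 1 ∧ (∀ k ∈ T, w k = 0) ∧ (∀ i, v i = m → w i = r) ∧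
        ∃ u ∈ F, C.Comb a w u := by
    intro T
    induction T using Finset.induction_on with
    | empty =>
      exact fun _ => ⟨fun _ => 1, 1, one_pos, le_rfl, by simp, by simp, _, hF.2.1, comb_one ha⟩
    | insert k T hk ih =>
      intro hT
      obtain ⟨w, r, hr0, hr1, hw0, hwr, u, huF, hu⟩ :=
        ih fun j hj => hT j (Finset.mem_insert_of_mem hj)
      obtain ⟨u', hu'F, hu'⟩ := hF.exists_sq_sub ha hs hsF (hs.1 k).1 (hs.1 k).2
      by_cases hm : ∃ i, v i = m
      · obtain ⟨i, hi⟩ := hm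
        have hne : m - v k ≠ 0 :=
          sub_ne_zero.2 (Ne.symm (hT k (Finset.mem_insert_self _ _)))
        have hb := (hu'.1 i).2
        simp only [hi] at hb
        refine ⟨_, r * ((m - v k) ^ 2 / 2), by positivity,
          mul_le_one₀ hr1 (by positivity) hb, ?_, ?_, _, hF.2.2.2.2.2 _ huF _ hu'F,
          hu.seq ha hu'⟩
        · intro j hj
          rcases Finset.mem_insert.1 hj with rfl | hj
          · simp
          · simp [hw0 j hj]
        · intro j hj
          simp only [hwr j hj, hj]
      · refine ⟨_, 1, one_pos, le_rfl, ?_, fun i hi => absurd ⟨i, hi⟩ hm, _,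
          hF.2.2.2.2.2 _ huF _ hu'F, hu.seq ha hu'⟩
        intro j hj
        rcases Finset.mem_insert.1 hj with rfl | hj
        · simp
        · simp [hw0 j hj]
  obtain ⟨w, r, hr0, hr1, hw0, hwr, u, huF, hu⟩ :=
    key (Finset.univ.filter fun k => v k ≠ m) (by simp)
  obtain ⟨e, he⟩ := ha.exists_comb (v := fun i => if v i = m then (1 : ℝ) else 0)
    fun i => by split_ifs <;> norm_num
  refine ⟨e, hF.mem_of_smul_mem hr0 hr1 ?_, he⟩
  have hre := he.smul hr0.le hr1
  have hw : (fun i => r * if v i = m then (1 : ℝ) else 0) = w := by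
    funext i
    split_ifs with h
    · rw [hwr i h, mul_one]
    · rw [hw0 i (by simpa using h), mul_zero]
  rw [hw] at hre
  rwa [hre.unique hu]

/-- Elements of a sub-COSEA below one of its minimal sharp elements `p` are multiples of `p`. -/
theorem IsSubCOSEA.eq_smul_of_le_minSharp (hF : C.IsSubCOSEA F) (ha : C.IsResolution a)
    (h0 : ∀ i, a i ≠ C.zero) (hs : C.Comb a v s) (hsF : s ∈ F) {p : E} (hp : C.MinSharp F p)
    (hsp : C.le s p) : ∃ r : ℝ, 0 ≤ r ∧ r ≤ 1 ∧ s = C.smul r p := by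
  obtain ⟨-, hps, -, hmin⟩ := hp
  rcases isEmpty_or_nonempty ι with hι | hι
  · have h := hs.2
    rw [Finset.univ_eq_empty, Finset.sum_empty] at h
    exact ⟨0, le_rfl, zero_le_one, by rw [C.zero_smul]; exact (C.of_injective h).symm⟩
  obtain ⟨k, hk⟩ := Finite.exists_max v
  obtain ⟨hk0, hk1⟩ := hs.1 k
  rcases hk0.eq_or_lt with hz | hpos
  · have hv : v = fun _ => 0 := funext fun i =>
      le_antisymm ((hk i).trans hz.ge) (hs.1 i).1
    rw [hv] at hs
    exact ⟨0, le_rfl, zero_le_one, by rw [C.zero_smul]; exact hs.unique comb_zero⟩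
  obtain ⟨e, heF, he⟩ := hF.exists_projection ha hs hsF (v k)
  have hes : C.IsSharp e := by
    rw [C.isSharp_iff]
    refine (he.seq ha he).unique ?_
    simpa only [mul_ite, mul_one, mul_zero, ite_self, ← ite_and, and_self] using he
  have hse := he.seq ha hs
  have hv : (fun i => (if v i = v k then (1 : ℝ) else 0) * v i) =
      fun i => v k * if v i = v k then (1 : ℝ) else 0 := by
    funext i
    split_ifs with h
    · rw [h, mul_comm]
    · simp
  rw [hv] at hse
  have hes_eq : C.seq e s = C.smul (v k) e := hse.unique (he.smul hk0 hk1)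
  have hcomm : C.seq e s = C.seq s e := by
    have := hs.seq ha he
    simp only [mul_comm (v _)] at this
    rw [hv] at this
    exact hse.unique this
  have hep : C.le e p := by
    refine hps.le_of_smul_le hpos hk1 (C.le_trans ?_ hsp)
    rw [← hes_eq, hcomm]
    exact C.seq_le_left _ _
  have he0 : e ≠ C.zero := by
    rintro rfl
    have := he.smul_le k
    simp only [if_true, C.one_smul] at this
    exact h0 k (C.eq_zero_of_le_zero this)
  have hpe := hmin e heF hes he0 hep
  subst hpe
  exact ⟨v k, hk0, hk1, by rw [← hes_eq, (hes.seq_eq_of_le hsp).1]⟩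

end Sub

/-! ### Finite-dimensional spectral COSEAs -/

theorem Spectral.exists_resolution {C : COSEA E} (hSp : C.Spectral) (b : E) :
    ∃ (n : ℕ) (a : Fin n → E) (v : Fin n → ℝ),
      C.IsResolution a ∧ (∀ i, C.IsOneDim (a i)) ∧ C.Comb a v b := by
  obtain ⟨_, -, n, a, v, ha, -, hv⟩ := hSp.2 b
  exact ⟨n, a, v, ⟨fun i => (ha.2.1 i).1, C.sumList_ofFn_iff.1 ha.2.2⟩, ha.2.1,
    C.spanRep_iff_comb.1 hv⟩

theorem Spectral.exists_isOneDim_le {C : COSEA E} (hSp : C.Spectral) {p : E}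
    (hp : C.IsSharp p) (h0 : p ≠ C.zero) : ∃ a, C.IsOneDim a ∧ C.le a p := by
  obtain ⟨n, a, v, -, ha1, hv⟩ := hSp.exists_resolution p
  by_cases h : ∃ i, 0 < v i
  · obtain ⟨i, hi⟩ := h
    exact ⟨a i, ha1 i, hp.le_of_smul_le hi (hv.1 i).2 (hv.smul_le i)⟩
  · push Not at h
    have hv0 : v = fun _ => 0 := funext fun i => le_antisymm (h i) (hv.1 i).1
    rw [hv0] at hv
    exact absurd (hv.unique comb_zero) h0

theorem Spectral.wellFounded_sharp {C : COSEA E} (hSp : C.Spectral) (hFD : C.FinDim) :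
    WellFounded fun q p : {p // C.IsSharp p} =>
      ∃ d, d ≠ C.zero ∧ C.of q.1 + C.of d = C.of p.1 := by
  rw [wellFounded_iff_isEmpty_descending_chain]
  refine ⟨fun ⟨p, hp⟩ => hFD ?_⟩
  choose d hd0 hd using hp
  have hone : ∀ i, ∃ f, C.IsOneDim f ∧ C.le f (d i) := fun i =>
    hSp.exists_isOneDim_le ((p i).2.of_add (p (i + 1)).2 (hd i)) (hd0 i)
  choose f hf hfd using hone
  refine ⟨f, hf, fun n => ?_⟩
  have hg : ∀ i, ∃ g, C.of (f i) + C.of g = C.of (d i) := fun i => C.le_iff.1 (hfd i)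
  choose g hg using hg
  have hsum : ∀ n, ∑ i ∈ Finset.range n, C.of (f i) +
      (∑ i ∈ Finset.range n, C.of (g i) + C.of (p n).1) = C.of (p 0).1 := by
    intro n
    induction n with
    | zero => simp
    | succ n ih =>
      rw [← ih, Finset.sum_range_succ, Finset.sum_range_succ, ← hd n, ← hg n]
      abel
  obtain ⟨s, _, hs, -⟩ := C.exists_of_add_eq (hsum n)
  refine ⟨s, C.sumList_iff.2 ?_⟩
  rw [List.map_map, ← hs]
  rfl

theorem IsSubCOSEA.exists_sumList_minSharp {C : COSEA E} {F : Set E} (hF : C.IsSubCOSEA F)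
    (hSp : C.Spectral) (hFD : C.FinDim) {p : E} (hp : C.IsSharp p) (hpF : p ∈ F) :
    ∃ l : List E, (∀ x ∈ l, C.MinSharp F x) ∧ C.SumList l p := by
  suffices h : ∀ p : {p // C.IsSharp p}, p.1 ∈ F →
      ∃ l : List E, (∀ x ∈ l, C.MinSharp F x) ∧ C.SumList l p.1 from h ⟨p, hp⟩ hpF
  intro p
  induction p using (hSp.wellFounded_sharp hFD).induction with
  | _ p ih =>
    intro hpF
    by_cases h0 : p.1 = C.zero
    · exact ⟨[], by simp, h0 ▸ SumList.nil⟩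
    by_cases hmin : C.MinSharp F p.1
    · refine ⟨[p.1], by simpa using hmin, C.sumList_iff.2 (by simp)⟩
    have hex : ∃ b ∈ F, C.IsSharp b ∧ b ≠ C.zero ∧ C.le b p.1 ∧ b ≠ p.1 := by
      by_contra! hcon
      exact hmin ⟨hpF, p.2, h0, hcon⟩
    obtain ⟨b, hbF, hb, hb0, hbp, hne⟩ := hex
    obtain ⟨d, hd⟩ := C.le_iff.1 hbp
    have hd0 : d ≠ C.zero := by
      rintro rfl
      rw [C.of_zero, add_zero] at hd
      exact hne (C.of_injective hd)
    obtain ⟨l, hl, hls⟩ := ih ⟨b, hb⟩ ⟨d, hd0, hd⟩ hbF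
    obtain ⟨l', hl', hls'⟩ := ih ⟨d, p.2.of_add hb hd⟩ ⟨b, hb0, (add_comm _ _).trans hd⟩
      (hF.sub_mem hpF hbF hd)
    refine ⟨l ++ l', fun x hx => (List.mem_append.1 hx).elim (hl x) (hl' x), ?_⟩
    rw [C.sumList_iff] at hls hls' ⊢
    rw [List.map_append, List.sum_append, hls, hls', hd]

end COSEA

/-- characterization of commutative sub-COSEAs by minimal sharp
elements. -/
theorem commutative_subCOSEA_iff {E : Type u} (C : COSEA E)
    (hFD : C.FinDim) (hSp : C.Spectral) (F : Set E) :
    (C.IsSubCOSEA F ∧ ∀ a ∈ F, ∀ b ∈ F, C.seq a b = C.seq b a) ↔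
      ∃ (n : ℕ) (a : Fin n → E), Function.Injective a ∧
        (∀ i, C.MinSharp F (a i)) ∧ C.SumList (List.ofFn a) C.one ∧
        F = {b | ∃ lam : Fin n → ℝ, C.SpanRep a lam b} := by
  constructor
  · rintro ⟨hF, hcomm⟩
    have hone : C.IsSharp C.one := C.isSharp_iff.2 (C.one_seq _)
    obtain ⟨l, hl, hsum⟩ := hF.exists_sumList_minSharp hSp hFD hone hF.2.1
    have hmin : ∀ i, C.MinSharp F (l.get i) := fun i => hl _ (List.get_mem l i)
    have hofFn : C.SumList (List.ofFn l.get) C.one := by rwa [List.ofFn_get]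
    have hsum' := C.sumList_ofFn_iff.1 hofFn
    refine ⟨l.length, l.get, C.injective_of_sum (fun i => (hmin i).2.1)
      (fun i => (hmin i).2.2.1) hsum', hmin, hofFn, ?_⟩
    simp only [C.spanRep_iff_comb]
    refine Set.Subset.antisymm (fun b hb => ?_) ?_
    · have hr : ∀ i, ∃ r : ℝ, 0 ≤ r ∧ r ≤ 1 ∧ C.seq (l.get i) b = C.smul r (l.get i) := by
        intro i
        obtain ⟨n, a, v, ha, ha1, hv⟩ := hSp.exists_resolution (C.seq (l.get i) b)
        exact hF.eq_smul_of_le_minSharp ha (fun j => (ha1 j).2.1) hv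
          (hF.2.2.2.2.2 _ (hmin i).1 _ hb) (hmin i) (C.seq_le_left _ _)
      choose r hr0 hr1 hr using hr
      refine ⟨r, fun i => ⟨hr0 i, hr1 i⟩, ?_⟩
      rw [← C.seq_one b, ← C.seq_sum b hsum']
      exact Finset.sum_congr rfl fun i _ => by rw [← hr, hcomm _ (hmin i).1 _ hb]
    · rintro b ⟨v, hv⟩
      exact hF.sum_mem (fun i _ => hF.2.2.2.1 _ (hv.1 i).1 (hv.1 i).2 _ (hmin i).1) hv.2
  · rintro ⟨n, a, -, hmin, hsum, hFeq⟩
    have h := COSEA.IsResolution.isSubCOSEA (C := C) (a := a)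
      ⟨fun i => (hmin i).2.1, C.sumList_ofFn_iff.1 hsum⟩ fun i => (hmin i).2.2.1
    simp only [← C.spanRep_iff_comb] at h
    rwa [← hFeq] at h
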